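/- arXiv:1212.1053 — 2 statements merged into one kernel-verified Lean document; each statement's English description precedes it below -/
import Mathlib

section
/- The ring E, consisting of all formal Laurent series Σ_{i∈ℤ} a_i u^i with coefficients in K such that v_K(a_i) + νi is bounded below and v_K(a_i) + νi → +∞ as i → −∞, is a field. -/
noncomputable section

/-- Lift of `WithTop ℤ` (the value monoid of the valuation of `K`) into `EReal`. -/
def toE (t : WithTop ℤ) : EReal :=
  WithTop.recTopCoe ⊤ (fun n : ℤ => ((n : ℝ) : EReal)) t

variable {K : Type} [Field K]

/-- For a formal Laurent series given by its coefficient function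
`f : ℤ → K`, the quantity `v_K(f i) + ν·i ∈ EReal`. -/
def lterm (vK : K → WithTop ℤ) (ν : ℚ) (f : ℤ → K) (i : ℤ) : EReal :=
  toE (vK (f i)) + (((ν * i : ℚ) : ℝ) : EReal)

/-- The Gauss valuation `v_ν(f) = inf_{i ∈ ℤ} (v_K(f i) + ν·i)` of a formal
Laurent series. -/
def vGL (vK : K → WithTop ℤ) (ν : ℚ) (f : ℤ → K) : EReal :=
  ⨅ i : ℤ, lterm vK ν f i

/-- Partial sums approximating the `n`-th coefficient of the product of two
formal Laurent series. -/
def psum (f g : ℤ → K) (n : ℤ) (N : ℕ) : K :=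
  ∑ i ∈ Finset.Icc (-(N : ℤ)) (N : ℤ), f i * g (n - i)

/-- Multiplication of formal Laurent series: the `n`-th coefficient is the
limit (with respect to the valuation `vK`) of the partial sums
`Σ_{|i| ≤ N} f i · g (n−i)`, when this limit exists (and `0` otherwise). -/
def mulL (vK : K → WithTop ℤ) (f g : ℤ → K) : ℤ → K := fun n =>
  @dite K
    (∃ l : K, ∀ m : ℤ, ∃ N0 : ℕ, ∀ N : ℕ, N0 ≤ N →
      (m : WithTop ℤ) ≤ vK (psum f g n N - l))
    (Classical.propDecidable _) (fun h => h.choose) (fun _ => 0)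

/-- The Laurent series `1`. -/
def oneL : ℤ → K := fun n => if n = 0 then 1 else 0

/-- The ring `E`: formal Laurent series `Σ_{i∈ℤ} aᵢuⁱ` with `v_K(aᵢ) + ν·i`
bounded below and `v_K(aᵢ) + ν·i → +∞` as `i → −∞`. -/
def ESet (vK : K → WithTop ℤ) (ν : ℚ) : Set (ℤ → K) :=
  {f | (∃ c : ℚ, ∀ i : ℤ, ((c : ℝ) : EReal) ≤ lterm vK ν f i) ∧
    ∀ m : ℚ, ∃ N : ℤ, ∀ i : ℤ, i ≤ N → ((m : ℝ) : EReal) ≤ lterm vK ν f i}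

open Filter Topology

namespace GaussLaurent

section Ultrametric

variable {L : Type} [NormedField L]

/-- The weighted norm of the `i`-th coefficient of a formal Laurent series. -/
def weight (ρ : ℝ) (f : ℤ → L) (i : ℤ) : ℝ := ‖f i‖ * ρ ^ i

/-- The convolution of two two-sided sequences. -/
def conv (f g : ℤ → L) (n : ℤ) : L := ∑' i, f i * g (n - i)

/-- Laurent series with bounded weighted coefficients which are small near `-∞`. -/
structure IsBoundedLaurent (ρ : ℝ) (f : ℤ → L) : Prop where
  bounded : ∃ C, ∀ i, weight ρ f i ≤ C
  small : ∀ ε > 0, ∃ N, ∀ i ≤ N, weight ρ f i ≤ ε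

variable {ρ : ℝ} {f g h : ℤ → L}

theorem weight_nonneg (hρ : 0 < ρ) (f : ℤ → L) (i : ℤ) : 0 ≤ weight ρ f i := by
  unfold weight; positivity

theorem norm_eq_weight_mul (hρ : 0 < ρ) (f : ℤ → L) (i : ℤ) : ‖f i‖ = weight ρ f i * ρ ^ (-i) := by
  have := (zpow_pos hρ i).ne'
  rw [weight, zpow_neg]; field_simp

theorem norm_mul_eq (hρ : 0 < ρ) (f g : ℤ → L) (n i : ℤ) :
    ‖f i * g (n - i)‖ = weight ρ f i * weight ρ g (n - i) * ρ ^ (-n) := by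
  rw [norm_mul, norm_eq_weight_mul hρ, norm_eq_weight_mul hρ g,
    show -n = -i + -(n - i) by ring, zpow_add₀ hρ.ne']
  ring

theorem IsBoundedLaurent.exists_pos_bound (hf : IsBoundedLaurent ρ f) :
    ∃ C > 0, ∀ i, weight ρ f i ≤ C := by
  obtain ⟨C, hC⟩ := hf.bounded
  exact ⟨max C 1, by positivity, fun i => (hC i).trans (le_max_left _ _)⟩

theorem IsBoundedLaurent.mul_small (hρ : 0 < ρ) (hf : IsBoundedLaurent ρ f)
    (hg : IsBoundedLaurent ρ g) {ε : ℝ} (hε : 0 < ε) :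
    ∃ N, ∀ i j, i ≤ N ∨ j ≤ N → weight ρ f i * weight ρ g j ≤ ε := by
  obtain ⟨A, hA, hfA⟩ := hf.exists_pos_bound
  obtain ⟨B, hB, hgB⟩ := hg.exists_pos_bound
  obtain ⟨M, hM⟩ := hf.small (ε / B) (by positivity)
  obtain ⟨N, hN⟩ := hg.small (ε / A) (by positivity)
  refine ⟨min M N, fun i j hij => ?_⟩
  rcases hij with hi | hj
  · calc _ ≤ ε / B * B := mul_le_mul (hM i (hi.trans (min_le_left _ _))) (hgB j)
          (weight_nonneg hρ _ _) (by positivity)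
      _ = ε := by field_simp
  · calc _ ≤ A * (ε / A) := mul_le_mul (hfA i) (hN j (hj.trans (min_le_right _ _)))
          (weight_nonneg hρ _ _) hA.le
      _ = ε := by field_simp

theorem IsBoundedLaurent.neg (hf : IsBoundedLaurent ρ f) :
    IsBoundedLaurent ρ (fun n => -f n) := by
  constructor
  · simpa [weight] using hf.bounded
  · simpa [weight] using hf.small

theorem conv_comm (f g : ℤ → L) : conv f g = conv g f := by
  funext n
  rw [conv, ← (Equiv.subLeft n).tsum_eq]
  simp [conv, mul_comm]

theorem conv_oneL_left (f : ℤ → L) : conv oneL f = f := by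
  funext n
  rw [conv, tsum_eq_single 0]
  · simp [oneL]
  · intro i hi
    simp [oneL, hi]

theorem isBoundedLaurent_of_norm_le (hρ : 0 < ρ) (hf : IsBoundedLaurent ρ f)
    (hgf : ∀ i, ‖g i‖ ≤ ‖f i‖) : IsBoundedLaurent ρ g := by
  have hle : ∀ i, weight ρ g i ≤ weight ρ f i := fun i => by
    unfold weight; gcongr; exact hgf i
  constructor
  · obtain ⟨C, hC⟩ := hf.bounded
    exact ⟨C, fun i => (hle i).trans (hC i)⟩
  · intro ε hε
    obtain ⟨N, hN⟩ := hf.small ε hε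
    exact ⟨N, fun i hi => (hle i).trans (hN i hi)⟩

theorem weight_oneL_le (ρ : ℝ) (i : ℤ) : weight ρ (oneL : ℤ → L) i ≤ 1 := by
  by_cases hi : i = 0 <;> simp [weight, oneL, hi]

theorem isBoundedLaurent_oneL (ρ : ℝ) : IsBoundedLaurent ρ (oneL : ℤ → L) := by
  refine ⟨⟨1, weight_oneL_le ρ⟩, fun ε hε => ⟨-1, fun i hi => ?_⟩⟩
  have : i ≠ 0 := by omega
  simpa [weight, oneL, this] using hε.le

theorem conv_inverse_eq_oneL {i₀ : ℤ} (hf : ∀ i < i₀, f i = 0) (hf₀ : f i₀ ≠ 0)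
    (hg : ∀ j, g j = if 0 ≤ j + i₀ then
      PowerSeries.coeff (j + i₀).toNat (PowerSeries.mk fun k => f (i₀ + k))⁻¹ else 0) :
    conv f g = oneL := by
  funext n
  have hinj : Function.Injective fun k : ℕ => i₀ + (k : ℤ) := fun a b hab => by simpa using hab
  rw [conv, ← hinj.tsum_eq]
  · rcases lt_or_ge n 0 with hn | hn
    · have hz : ∀ k : ℕ, f (i₀ + k) * g (n - (i₀ + k)) = 0 := fun k => by
        rw [hg, if_neg (by omega), mul_zero]
      simp [hz, oneL, hn.ne]
    · lift n to ℕ using hn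
      rw [tsum_eq_sum (s := Finset.range (n + 1))]
      · have hmul := congrArg (PowerSeries.coeff n) (PowerSeries.mul_inv_cancel
          (PowerSeries.mk fun k : ℕ => f (i₀ + k)) (by simpa using hf₀))
        rw [PowerSeries.coeff_mul, Finset.Nat.sum_antidiagonal_eq_sum_range_succ_mk,
          PowerSeries.coeff_one] at hmul
        simp only [oneL, Nat.cast_eq_zero, ← hmul]
        refine Finset.sum_congr rfl fun k hk => ?_
        have hk' : k ≤ n := Finset.mem_range_succ_iff.1 hk
        rw [hg, if_pos (by omega), PowerSeries.coeff_mk,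
          show ((n : ℤ) - (i₀ + k) + i₀).toNat = n - k by omega]
      · intro k hk
        rw [hg, if_neg, mul_zero]
        simp only [Finset.mem_range] at hk
        omega
  · intro i hi
    by_contra hcon
    have : i < i₀ := by
      by_contra! hle
      exact hcon ⟨(i - i₀).toNat, by simp; omega⟩
    exact hi (by simp [hf i this])

variable [IsUltrametricDist L]

theorem weight_add_le (hρ : 0 < ρ) (f g : ℤ → L) (i : ℤ) :
    weight ρ (fun n => f n + g n) i ≤ max (weight ρ f i) (weight ρ g i) := by
  unfold weight
  rw [← max_mul_of_nonneg _ _ (by positivity)]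
  gcongr
  exact IsUltrametricDist.norm_add_le_max _ _

theorem IsBoundedLaurent.add (hρ : 0 < ρ) (hf : IsBoundedLaurent ρ f)
    (hg : IsBoundedLaurent ρ g) : IsBoundedLaurent ρ (fun n => f n + g n) := by
  constructor
  · obtain ⟨A, hA⟩ := hf.bounded
    obtain ⟨B, hB⟩ := hg.bounded
    exact ⟨max A B, fun i => (weight_add_le hρ f g i).trans (max_le_max (hA i) (hB i))⟩
  · intro ε hε
    obtain ⟨M, hM⟩ := hf.small ε hε
    obtain ⟨N, hN⟩ := hg.small ε hε
    exact ⟨min M N, fun i hi => (weight_add_le hρ f g i).trans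
      (max_le (hM i (hi.trans (min_le_left _ _))) (hN i (hi.trans (min_le_right _ _))))⟩

theorem weight_tsum_le {α : Type*} (hρ : 0 < ρ) {F : ℤ → α → L} {i : ℤ} {C : ℝ} (hC : 0 ≤ C)
    (hF : ∀ a, weight ρ (fun n => F n a) i ≤ C) : weight ρ (fun n => ∑' a, F n a) i ≤ C := by
  have hpos := zpow_pos hρ i
  simp only [weight] at hF ⊢
  rw [← le_div_iff₀ hpos]
  exact IsUltrametricDist.norm_tsum_le_of_forall_le_of_nonneg (by positivity)
    fun a => (le_div_iff₀ hpos).2 (hF a)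

theorem weight_conv_le (hρ : 0 < ρ) {n : ℤ} {C : ℝ} (hC : 0 ≤ C)
    (h : ∀ i, weight ρ f i * weight ρ g (n - i) ≤ C) : weight ρ (conv f g) n ≤ C := by
  refine weight_tsum_le hρ (F := fun n i => f i * g (n - i)) hC fun i => ?_
  rw [weight, norm_mul_eq hρ, mul_assoc, ← zpow_add₀ hρ.ne', neg_add_cancel, zpow_zero, mul_one]
  exact h i

theorem IsBoundedLaurent.conv (hρ : 0 < ρ) (hf : IsBoundedLaurent ρ f)
    (hg : IsBoundedLaurent ρ g) : IsBoundedLaurent ρ (conv f g) := by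
  constructor
  · obtain ⟨A, hA, hfA⟩ := hf.exists_pos_bound
    obtain ⟨B, hB, hgB⟩ := hg.exists_pos_bound
    exact ⟨A * B, fun n => weight_conv_le hρ (by positivity) fun i =>
      mul_le_mul (hfA i) (hgB _) (weight_nonneg hρ _ _) hA.le⟩
  · intro ε hε
    obtain ⟨N, hN⟩ := hf.mul_small hρ hg hε
    exact ⟨2 * N, fun n hn => weight_conv_le hρ hε.le fun i => hN _ _ (by omega)⟩

theorem isBoundedLaurent_tsum (hρ : 0 < ρ) {t : ℕ → ℤ → L} {b : ℕ → ℝ}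
    (hb : Tendsto b atTop (𝓝 0)) (ht : ∀ k, IsBoundedLaurent ρ (t k))
    (htb : ∀ k i, weight ρ (t k) i ≤ b k) : IsBoundedLaurent ρ (fun n => ∑' k, t k n) := by
  constructor
  · obtain ⟨C, hC⟩ := hb.bddAbove_range
    have htC : ∀ k i, weight ρ (t k) i ≤ C := fun k i => (htb k i).trans (hC ⟨k, rfl⟩)
    have hC0 : 0 ≤ C := (weight_nonneg hρ (t 0) 0).trans (htC 0 0)
    exact ⟨C, fun i => weight_tsum_le hρ (F := fun n k => t k n) hC0 fun k => htC k i⟩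
  · intro ε hε
    obtain ⟨k₀, hk₀⟩ := eventually_atTop.1 (hb.eventually (ge_mem_nhds hε))
    have hfin : ∀ᶠ i in atBot, ∀ k ∈ Finset.range k₀, weight ρ (t k) i ≤ ε :=
      (Filter.eventually_all_finset _).2 fun k _ => eventually_atBot.2 ((ht k).small ε hε)
    obtain ⟨N, hN⟩ := eventually_atBot.1 hfin
    refine ⟨N, fun i hi => weight_tsum_le hρ (F := fun n k => t k n) hε.le fun k => ?_⟩
    rcases lt_or_ge k k₀ with hk | hk
    · exact hN i hi k (Finset.mem_range.2 hk)
    · exact (htb k i).trans (hk₀ k hk)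

/-- The powers of `-d` with respect to convolution. -/
def negPow (d : ℤ → L) : ℕ → ℤ → L
  | 0 => oneL
  | k + 1 => fun n => -conv d (negPow d k) n

theorem isBoundedLaurent_negPow (hρ : 0 < ρ) (hf : IsBoundedLaurent ρ f) (k : ℕ) :
    IsBoundedLaurent ρ (negPow f k) := by
  induction k with
  | zero => exact isBoundedLaurent_oneL ρ
  | succ k ih => exact (hf.conv hρ ih).neg

theorem weight_negPow_le (hρ : 0 < ρ) {r : ℝ} (hr : 0 ≤ r) (hf : ∀ i, weight ρ f i ≤ r) (k : ℕ)
    (i : ℤ) : weight ρ (negPow f k) i ≤ r ^ k := by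
  induction k generalizing i with
  | zero => simpa [negPow] using weight_oneL_le ρ i
  | succ k ih =>
    have : weight ρ (conv f (negPow f k)) i ≤ r ^ (k + 1) :=
      weight_conv_le hρ (by positivity) fun j => by
        rw [pow_succ']
        exact mul_le_mul (hf j) (ih _) (weight_nonneg hρ _ _) hr
    simpa [weight, negPow] using this

theorem norm_coeff_inv_le (hρ : 0 < ρ) {p : PowerSeries L}
    (hp : ∀ n, ‖PowerSeries.coeff n p‖ * ρ ^ n ≤ ‖PowerSeries.constantCoeff p‖) (n : ℕ) :
    ‖PowerSeries.coeff n p⁻¹‖ * ρ ^ n ≤ ‖PowerSeries.constantCoeff p‖⁻¹ := by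
  induction n using Nat.strong_induction_on with
  | _ n ih =>
    have hpos := pow_pos hρ n
    rw [PowerSeries.coeff_inv]
    split_ifs with hn
    · simp [hn]
    · rw [norm_mul, norm_neg, norm_inv, mul_assoc]
      refine mul_le_of_le_one_right (by positivity) ?_
      rw [← le_div_iff₀ hpos]
      refine IsUltrametricDist.norm_sum_le_of_forall_le_of_nonneg (by positivity) fun x hx => ?_
      split_ifs with hx2
      · rw [le_div_iff₀ hpos, ← Finset.HasAntidiagonal.mem_antidiagonal.1 hx, pow_add, norm_mul]
        calc _ = (‖PowerSeries.coeff x.1 p‖ * ρ ^ x.1) *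
              (‖PowerSeries.coeff x.2 p⁻¹‖ * ρ ^ x.2) := by ring
          _ ≤ ‖PowerSeries.constantCoeff p‖ * ‖PowerSeries.constantCoeff p‖⁻¹ :=
            mul_le_mul (hp _) (ih _ hx2) (by positivity) (by positivity)
          _ ≤ 1 := mul_inv_le_one
      · simpa using by positivity

variable [CompleteSpace L]

theorem summable_of_finite_lt_norm {α : Type*} {F : α → L}
    (hF : ∀ ε > 0, {a | ε < ‖F a‖}.Finite) : Summable F := by
  refine NonarchimedeanAddGroup.summable_of_tendsto_cofinite_zero ?_
  rw [tendsto_zero_iff_norm_tendsto_zero]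
  refine Metric.tendsto_nhds.2 fun ε hε => ?_
  filter_upwards [(hF (ε / 2) (by positivity)).compl_mem_cofinite] with a ha
  have : ‖F a‖ ≤ ε / 2 := by simpa using ha
  simpa using this.trans_lt (half_lt_self hε)

theorem summable_of_finite_lt_norm_mul {α : Type*} {F : α → L} {c : ℝ} (hc : 0 < c)
    (hF : ∀ ε > 0, {a | ε < ‖F a‖ * c}.Finite) : Summable F :=
  summable_of_finite_lt_norm fun ε hε => (hF (ε * c) (by positivity)).subset fun _ ha =>
    mul_lt_mul_of_pos_right ha hc

theorem IsBoundedLaurent.summable_mul (hρ : 0 < ρ) (hf : IsBoundedLaurent ρ f)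
    (hg : IsBoundedLaurent ρ g) (n : ℤ) : Summable fun i => f i * g (n - i) := by
  refine summable_of_finite_lt_norm_mul (zpow_pos hρ n) fun ε hε => ?_
  obtain ⟨N, hN⟩ := hf.mul_small hρ hg hε
  refine (Set.finite_Icc N (n - N)).subset fun i hi => ?_
  rw [Set.mem_ofPred, norm_mul_eq hρ, mul_assoc, ← zpow_add₀ hρ.ne', neg_add_cancel, zpow_zero,
    mul_one] at hi
  by_contra hcon
  refine absurd (hN i (n - i) ?_) hi.not_ge
  simp only [Set.mem_Icc, not_and_or] at hcon
  omega

theorem conv_add (hρ : 0 < ρ) (hf : IsBoundedLaurent ρ f) (hg : IsBoundedLaurent ρ g)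
    (hh : IsBoundedLaurent ρ h) :
    conv f (fun n => g n + h n) = fun n => conv f g n + conv f h n := by
  funext n
  simp only [conv, mul_add]
  exact (hf.summable_mul hρ hg n).tsum_add (hf.summable_mul hρ hh n)

theorem IsBoundedLaurent.summable_mul_mul (hρ : 0 < ρ) (hf : IsBoundedLaurent ρ f)
    (hg : IsBoundedLaurent ρ g) (hh : IsBoundedLaurent ρ h) (n : ℤ) :
    Summable fun p : ℤ × ℤ => f p.2 * g (p.1 - p.2) * h (n - p.1) := by
  refine summable_of_finite_lt_norm_mul (zpow_pos hρ n) fun ε hε => ?_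
  obtain ⟨A, hA, hfA⟩ := hf.exists_pos_bound
  obtain ⟨C, hC, hhC⟩ := hh.exists_pos_bound
  obtain ⟨M, hM⟩ := hf.mul_small hρ hg (show 0 < ε / C by positivity)
  obtain ⟨N, hN⟩ := hg.mul_small hρ hh (show 0 < ε / A by positivity)
  set P := min M N
  refine ((Set.finite_Icc (2 * P) (n - P)).prod (Set.finite_Icc P (n - 2 * P))).subset ?_
  rintro ⟨m, i⟩ hmi
  have heq : ‖f i * g (m - i) * h (n - m)‖ * ρ ^ n =
      weight ρ f i * weight ρ g (m - i) * weight ρ h (n - m) := by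
    rw [norm_mul, norm_mul_eq hρ, weight, weight, weight,
      show n = m + (n - m) by ring, zpow_add₀ hρ.ne', zpow_neg]
    have := (zpow_pos hρ m).ne'
    simp only [add_sub_cancel_left]
    field_simp
  simp only [Set.mem_ofPred, heq] at hmi
  by_contra hcon
  refine absurd ?_ hmi.not_ge
  have key : (i ≤ M ∨ m - i ≤ M) ∨ (m - i ≤ N ∨ n - m ≤ N) := by
    simp only [Set.mem_prod, Set.mem_Icc] at hcon
    omega
  rcases key with hk | hk
  · calc _ ≤ ε / C * C := mul_le_mul (hM _ _ hk) (hhC _) (weight_nonneg hρ _ _) (by positivity)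
      _ = ε := by field_simp
  · calc _ = weight ρ f i * (weight ρ g (m - i) * weight ρ h (n - m)) := by ring
      _ ≤ A * (ε / A) := mul_le_mul (hfA _) (hN _ _ hk)
        (mul_nonneg (weight_nonneg hρ _ _) (weight_nonneg hρ _ _)) hA.le
      _ = ε := by field_simp

theorem conv_assoc (hρ : 0 < ρ) (hf : IsBoundedLaurent ρ f) (hg : IsBoundedLaurent ρ g)
    (hh : IsBoundedLaurent ρ h) : conv (conv f g) h = conv f (conv g h) := by
  funext n
  calc conv (conv f g) h n = ∑' m, ∑' i, f i * g (m - i) * h (n - m) := by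
        simp only [conv, tsum_mul_right]
    _ = ∑' i, ∑' m, f i * g (m - i) * h (n - m) :=
        Summable.tsum_comm (hf.summable_mul_mul hρ hg hh n).prod_symm
    _ = conv f (conv g h) n := by
        refine tsum_congr fun i => ?_
        rw [conv, ← (Equiv.subRight i).tsum_eq (fun j => g j * h (n - i - j)), ← tsum_mul_left]
        refine tsum_congr fun m => ?_
        simp [mul_assoc]

theorem conv_tsum (hρ : 0 < ρ) {t : ℕ → ℤ → L} {b : ℕ → ℝ} (hb : Tendsto b atTop (𝓝 0))
    (hf : IsBoundedLaurent ρ f) (ht : ∀ k, IsBoundedLaurent ρ (t k))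
    (htb : ∀ k i, weight ρ (t k) i ≤ b k) (n : ℤ) :
    conv f (fun n => ∑' k, t k n) n = ∑' k, conv f (t k) n := by
  have hsum : Summable fun p : ℕ × ℤ => f p.2 * t p.1 (n - p.2) := by
    refine summable_of_finite_lt_norm_mul (zpow_pos hρ n) fun ε hε => ?_
    obtain ⟨A, hA, hfA⟩ := hf.exists_pos_bound
    obtain ⟨k₀, hk₀⟩ := eventually_atTop.1 (hb.eventually (ge_mem_nhds (show 0 < ε / A by positivity)))
    choose N hN using fun k => hf.mul_small hρ (ht k) hε
    refine ((Finset.range k₀).finite_toSet.biUnion fun k _ =>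
      (Set.finite_Icc (N k) (n - N k)).image (Prod.mk k)).subset ?_
    rintro ⟨k, i⟩ hki
    rw [Set.mem_ofPred, norm_mul_eq hρ, mul_assoc, ← zpow_add₀ hρ.ne', neg_add_cancel, zpow_zero,
      mul_one] at hki
    have hk : k < k₀ := by
      by_contra! hk
      refine absurd ?_ hki.not_ge
      calc _ ≤ A * (ε / A) := mul_le_mul (hfA i) ((htb k _).trans (hk₀ k hk))
            (weight_nonneg hρ _ _) hA.le
        _ = ε := by field_simp
    have hi : i ∈ Set.Icc (N k) (n - N k) := by
      by_contra hcon
      refine absurd (hN k i (n - i) ?_) hki.not_ge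
      simp only [Set.mem_Icc, not_and_or] at hcon
      omega
    exact Set.mem_biUnion (Finset.mem_coe.2 (Finset.mem_range.2 hk)) ⟨i, hi, rfl⟩
  calc conv f (fun n => ∑' k, t k n) n = ∑' i, ∑' k, f i * t k (n - i) := by
        simp only [conv, tsum_mul_left]
    _ = ∑' k, conv f (t k) n := Summable.tsum_comm hsum

theorem tsum_negPow_sub (hρ : 0 < ρ) {r : ℝ} (hr : 0 ≤ r) (hr1 : r < 1)
    (hf : ∀ i, weight ρ f i ≤ r) (n : ℤ) :
    ∑' k, (negPow f k n - negPow f (k + 1) n) = oneL n := by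
  have hlim : Tendsto (fun k => negPow f k n) atTop (𝓝 0) := by
    refine squeeze_zero_norm (a := fun k => r ^ k * ρ ^ (-n)) (fun k => ?_) ?_
    · rw [norm_eq_weight_mul hρ]
      gcongr
      exact weight_negPow_le hρ hr hf k n
    · simpa using (tendsto_pow_atTop_nhds_zero_of_lt_one hr hr1).mul_const (ρ ^ (-n))
  have hsum : Summable fun k => negPow f k n - negPow f (k + 1) n := by
    refine NonarchimedeanAddGroup.summable_of_tendsto_cofinite_zero ?_
    rw [Nat.cofinite_eq_atTop]
    simpa using hlim.sub (hlim.comp (tendsto_add_atTop_nat 1))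
  refine tendsto_nhds_unique hsum.hasSum.tendsto_sum_nat ?_
  simp only [Finset.sum_range_sub']
  simpa [negPow] using hlim.const_sub (negPow f 0 n)

/-- A series with an approximate inverse is invertible. -/
theorem exists_conv_eq_oneL_of_approx (hρ : 0 < ρ) (hf : IsBoundedLaurent ρ f)
    (hg : IsBoundedLaurent ρ g) (hh : IsBoundedLaurent ρ h) {r : ℝ} (hr : 0 ≤ r) (hr1 : r < 1)
    (hhr : ∀ i, weight ρ h i ≤ r) (hfg : conv f g = fun n => oneL n + h n) :
    ∃ g', IsBoundedLaurent ρ g' ∧ conv f g' = oneL := by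
  obtain ⟨A, hA, hgA⟩ := hg.exists_pos_bound
  have hpow := isBoundedLaurent_negPow hρ hh
  have ht : ∀ k, IsBoundedLaurent ρ (conv g (negPow h k)) := fun k => hg.conv hρ (hpow k)
  have htb : ∀ k i, weight ρ (conv g (negPow h k)) i ≤ A * r ^ k := fun k i =>
    weight_conv_le hρ (by positivity) fun j =>
      mul_le_mul (hgA j) (weight_negPow_le hρ hr hhr k _) (weight_nonneg hρ _ _) hA.le
  have hb : Tendsto (fun k => A * r ^ k) atTop (𝓝 0) := by
    simpa using (tendsto_pow_atTop_nhds_zero_of_lt_one hr hr1).const_mul A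
  refine ⟨_, isBoundedLaurent_tsum hρ hb ht htb, funext fun n => ?_⟩
  rw [conv_tsum hρ hb hf ht htb, ← tsum_negPow_sub hρ hr hr1 hhr n]
  refine tsum_congr fun k => ?_
  rw [← conv_assoc hρ hf hg (hpow k), hfg, conv_comm,
    conv_add hρ (hpow k) (isBoundedLaurent_oneL ρ) hh, conv_comm _ oneL, conv_oneL_left,
    conv_comm _ h]
  simp [negPow]

/-- A series whose weights attain their maximum, for the first time at `i₀`, is invertible. -/
theorem exists_conv_eq_oneL (hρ : 0 < ρ) (hf : IsBoundedLaurent ρ f) {i₀ : ℤ}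
    (hf₀ : f i₀ ≠ 0) (hle : ∀ i, weight ρ f i ≤ weight ρ f i₀)
    (hlt : ∀ i < i₀, weight ρ f i < weight ρ f i₀) :
    ∃ g, IsBoundedLaurent ρ g ∧ conv f g = oneL := by
  set M := weight ρ f i₀ with hM
  have hM0 : 0 < M := mul_pos (norm_pos_iff.2 hf₀) (zpow_pos hρ _)
  set f₁ : ℤ → L := fun i => if i < i₀ then f i else 0
  set f₂ : ℤ → L := fun i => if i < i₀ then 0 else f i
  have hf₁ : IsBoundedLaurent ρ f₁ := isBoundedLaurent_of_norm_le hρ hf fun i => by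
    simp only [f₁]; split_ifs <;> simp
  have hf₂ : IsBoundedLaurent ρ f₂ := isBoundedLaurent_of_norm_le hρ hf fun i => by
    simp only [f₂]; split_ifs <;> simp
  have hsplit : f = fun i => f₂ i + f₁ i := by
    funext i; simp only [f₁, f₂]; split_ifs <;> simp
  set p : PowerSeries L := PowerSeries.mk fun k : ℕ => f₂ (i₀ + k)
  have hpc : PowerSeries.constantCoeff p = f i₀ := by simp [p, f₂]
  set g : ℤ → L := fun j => if 0 ≤ j + i₀ then PowerSeries.coeff (j + i₀).toNat p⁻¹ else 0
  have hp : ∀ n, ‖PowerSeries.coeff n p‖ * ρ ^ n ≤ ‖PowerSeries.constantCoeff p‖ := fun n => by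
    have := hle (i₀ + n)
    rw [hM, weight, weight, zpow_add₀ hρ.ne', zpow_natCast, mul_left_comm,
      mul_comm (ρ ^ i₀)] at this
    have hn : ¬ (n : ℤ) < 0 := by omega
    simpa [hpc, p, f₂, hn] using le_of_mul_le_mul_right this (zpow_pos hρ i₀)
  have hgM : ∀ j, weight ρ g j ≤ M⁻¹ := fun j => by
    by_cases hj : 0 ≤ j + i₀
    · obtain ⟨n, hn⟩ := Int.eq_ofNat_of_zero_le hj
      have hq := norm_coeff_inv_le hρ hp n
      obtain rfl : j = n + -i₀ := by omega
      have hgj : g (n + -i₀) = PowerSeries.coeff n p⁻¹ := by simp [g]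
      rw [weight, hgj, zpow_add₀ hρ.ne', zpow_natCast, hM, weight, mul_inv, ← mul_assoc, zpow_neg,
        ← hpc]
      gcongr
    · simpa [weight, g, hj] using hM0.le
  have hg : IsBoundedLaurent ρ g :=
    ⟨⟨_, hgM⟩, fun ε hε => ⟨-i₀ - 1, fun j hj => by
      simpa [weight, g, show ¬ 0 ≤ j + i₀ by omega] using hε.le⟩⟩
  have hone : conv f₂ g = oneL :=
    conv_inverse_eq_oneL (fun i hi => by simp [f₂, hi]) (by simpa [f₂] using hf₀) fun _ => rfl
  obtain ⟨M', ⟨hM'1, hM'2⟩, hM'M⟩ : ∃ x, (M / 2 ≤ x ∧ ∀ i, weight ρ f₁ i ≤ x) ∧ x < M := by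
    obtain ⟨N, hN⟩ := hf.small (M / 2) (by positivity)
    have hev : ∀ᶠ x in 𝓝[<] M, ∀ i ∈ Finset.Ico N i₀, weight ρ f i ≤ x :=
      (Filter.eventually_all_finset _).2 fun i hi => by
        filter_upwards [Ioo_mem_nhdsLT (hlt i (Finset.mem_Ico.1 hi).2)] with x hx using hx.1.le
    have hev' : ∀ᶠ x in 𝓝[<] M, M / 2 ≤ x ∧ x < M := by
      filter_upwards [Ioo_mem_nhdsLT (half_lt_self hM0)] with x hx using ⟨hx.1.le, hx.2⟩
    obtain ⟨x, hx, hx1, hx2⟩ := (hev.and hev').exists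
    refine ⟨x, ⟨hx1, fun i => ?_⟩, hx2⟩
    by_cases hi : i < i₀
    · have : weight ρ f₁ i = weight ρ f i := by simp [weight, f₁, hi]
      rw [this]
      rcases le_total i N with hiN | hiN
      · exact (hN i hiN).trans hx1
      · exact hx i (Finset.mem_Ico.2 ⟨hiN, hi⟩)
    · have : weight ρ f₁ i = 0 := by simp [weight, f₁, hi]
      rw [this]
      exact (by positivity : 0 ≤ M / 2).trans hx1
  have hM'0 : 0 ≤ M' := (by positivity : 0 ≤ M / 2).trans hM'1
  refine exists_conv_eq_oneL_of_approx hρ hf hg (hf₁.conv hρ hg) (r := M' * M⁻¹) (by positivity)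
    (by rwa [← div_eq_mul_inv, div_lt_one hM0])
    (fun i => weight_conv_le hρ (by positivity) fun j =>
      mul_le_mul (hM'2 j) (hgM _) (weight_nonneg hρ _ _) hM'0) ?_
  conv_lhs => rw [hsplit]
  rw [conv_comm, conv_add hρ hg hf₂ hf₁, conv_comm g, conv_comm g, hone]

end Ultrametric

section Valuation

/-- The absolute value `2 ^ (-t)` attached to `t`, with `2 ^ (-∞) = 0`. -/
def expNeg (t : WithTop ℤ) : ℝ := WithTop.recTopCoe 0 (fun n : ℤ => (2 : ℝ) ^ (-n)) t

@[simp] theorem expNeg_top : expNeg ⊤ = 0 := rfl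

@[simp] theorem expNeg_coe (n : ℤ) : expNeg n = (2 : ℝ) ^ (-n) := rfl

theorem expNeg_nonneg (t : WithTop ℤ) : 0 ≤ expNeg t := by
  cases t with
  | top => simp
  | coe n => rw [expNeg_coe]; positivity

theorem expNeg_eq_zero {t : WithTop ℤ} : expNeg t = 0 ↔ t = ⊤ := by
  cases t with
  | top => simp
  | coe n => simpa using (zpow_pos two_pos n).ne'

theorem expNeg_add (s t : WithTop ℤ) : expNeg (s + t) = expNeg s * expNeg t := by
  cases s with
  | top => simp
  | coe m =>
    cases t with
    | top => simp
    | coe n =>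
      rw [← WithTop.coe_add, expNeg_coe, expNeg_coe, expNeg_coe, neg_add, zpow_add₀ two_ne_zero]

theorem expNeg_le_expNeg {s t : WithTop ℤ} : expNeg s ≤ expNeg t ↔ t ≤ s := by
  cases s with
  | top => simpa using expNeg_nonneg t
  | coe m =>
    cases t with
    | top => simpa using zpow_pos two_pos m
    | coe n =>
      rw [expNeg_coe, expNeg_coe, zpow_le_zpow_iff_right₀ one_lt_two, neg_le_neg_iff,
        WithTop.coe_le_coe]

theorem expNeg_min (s t : WithTop ℤ) : expNeg (min s t) = max (expNeg s) (expNeg t) :=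
  Antitone.map_min fun _ _ h => expNeg_le_expNeg.2 h

/-- The absolute value attached to a discrete valuation. -/
def absOfValuation {F : Type} [Field F] (v : F → WithTop ℤ) (hv_zero : ∀ x, v x = ⊤ ↔ x = 0)
    (hv_mul : ∀ x y, v (x * y) = v x + v y) (hv_add : ∀ x y, min (v x) (v y) ≤ v (x + y)) :
    AbsoluteValue F ℝ where
  toFun x := expNeg (v x)
  map_mul' x y := by rw [hv_mul, expNeg_add]
  nonneg' x := expNeg_nonneg _
  eq_zero' x := expNeg_eq_zero.trans (hv_zero x)
  add_le' x y := (expNeg_le_expNeg.2 (hv_add x y)).trans <| by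
    rw [expNeg_min]
    exact max_le_add_of_nonneg (expNeg_nonneg _) (expNeg_nonneg _)

variable {L : Type} [NormedField L] {v : L → WithTop ℤ} {ν : ℚ} {f g : ℤ → L}

theorem coe_le_iff_norm_le (hv : ∀ x, ‖x‖ = expNeg (v x)) (m : ℤ) (x : L) :
    (m : WithTop ℤ) ≤ v x ↔ ‖x‖ ≤ (2 : ℝ) ^ (-m) := by
  rw [hv, ← expNeg_coe, expNeg_le_expNeg]

theorem isUltrametricDist_of_valuation (hv : ∀ x, ‖x‖ = expNeg (v x))
    (hv_add : ∀ x y, min (v x) (v y) ≤ v (x + y)) : IsUltrametricDist L :=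
  IsUltrametricDist.isUltrametricDist_of_forall_norm_add_le_max_norm fun x y => by
    rw [hv, hv x, hv y, ← expNeg_min]
    exact expNeg_le_expNeg.2 (hv_add x y)

theorem exists_two_zpow_neg_natCast_lt {ε : ℝ} (hε : 0 < ε) :
    ∃ m : ℕ, (2 : ℝ) ^ (-(m : ℤ)) < ε := by
  obtain ⟨m, hm⟩ := exists_pow_lt_of_lt_one hε (show (2⁻¹ : ℝ) < 1 by norm_num)
  exact ⟨m, by simpa using hm⟩

theorem tendsto_iff_valuation (hv : ∀ x, ‖x‖ = expNeg (v x)) {x : ℕ → L} {l : L} :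
    Tendsto x atTop (𝓝 l) ↔ ∀ m : ℤ, ∃ N₀ : ℕ, ∀ N, N₀ ≤ N → (m : WithTop ℤ) ≤ v (x N - l) := by
  simp only [coe_le_iff_norm_le hv, Metric.tendsto_atTop, dist_eq_norm]
  constructor
  · intro h m
    obtain ⟨N, hN⟩ := h ((2 : ℝ) ^ (-m)) (by positivity)
    exact ⟨N, fun n hn => (hN n hn).le⟩
  · intro h ε hε
    obtain ⟨m, hm⟩ := exists_two_zpow_neg_natCast_lt hε
    obtain ⟨N, hN⟩ := h m
    exact ⟨N, fun n hn => (hN n hn).trans_lt hm⟩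

theorem completeSpace_of_valuation (hv : ∀ x, ‖x‖ = expNeg (v x))
    (hv_complete : ∀ x : ℕ → L,
      (∀ n : ℕ, ((n : ℤ) : WithTop ℤ) ≤ v (x (n + 1) - x n)) →
      ∃ l : L, ∀ n : ℕ, ((n : ℤ) : WithTop ℤ) ≤ v (l - x n)) : CompleteSpace L := by
  refine Metric.complete_of_convergent_controlled_sequences (fun n : ℕ => (2 : ℝ) ^ (-(n : ℤ)))
    (fun n => by positivity) fun u hu => ?_
  obtain ⟨l, hl⟩ := hv_complete u fun n => (coe_le_iff_norm_le hv _ _).2 <| by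
    rw [← dist_eq_norm]
    exact (hu n (n + 1) n n.le_succ le_rfl).le
  refine ⟨l, Metric.tendsto_atTop.2 fun ε hε => ?_⟩
  obtain ⟨m, hm⟩ := exists_two_zpow_neg_natCast_lt hε
  refine ⟨m, fun n hn => lt_of_le_of_lt ?_ hm⟩
  rw [dist_comm, dist_eq_norm]
  refine ((coe_le_iff_norm_le hv _ _).1 (hl n)).trans ?_
  exact zpow_le_zpow_right₀ one_le_two (by omega)

theorem weight_eq_rpow (hv : ∀ x, ‖x‖ = expNeg (v x)) {i n : ℤ} (hn : v (f i) = n) :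
    weight ((2 : ℝ) ^ (-ν : ℝ)) f i = (2 : ℝ) ^ (-(n + ν * i : ℝ)) := by
  rw [weight, hv, hn, expNeg_coe, ← Real.rpow_intCast, ← Real.rpow_intCast,
    ← Real.rpow_mul two_pos.le, ← Real.rpow_add two_pos]
  congr 1
  push_cast
  ring

theorem le_lterm_iff (hv : ∀ x, ‖x‖ = expNeg (v x)) (c : ℝ) (i : ℤ) :
    (c : EReal) ≤ lterm v ν f i ↔
      weight ((2 : ℝ) ^ (-ν : ℝ)) f i ≤ (2 : ℝ) ^ (-c) := by
  rcases h : v (f i) with _ | n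
  · have hf : ‖f i‖ = 0 := by rw [hv, h]; rfl
    have hl : lterm v ν f i = ⊤ := by
      rw [lterm, h]
      exact EReal.top_add_coe _
    simpa [hl, weight, hf] using by positivity
  · have hl : lterm v ν f i = ((n + ν * i : ℝ) : EReal) := by
      rw [lterm, h]
      push_cast
      rfl
    rw [hl, weight_eq_rpow hv h, EReal.coe_le_coe_iff, Real.rpow_le_rpow_left_iff one_lt_two,
      neg_le_neg_iff]

theorem exists_rat_two_rpow_neg_le {ε : ℝ} (hε : 0 < ε) : ∃ m : ℚ, (2 : ℝ) ^ (-(m : ℝ)) ≤ ε := by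
  obtain ⟨m, hm⟩ := exists_two_zpow_neg_natCast_lt hε
  refine ⟨m, le_of_eq_of_le ?_ hm.le⟩
  rw [← Real.rpow_intCast]
  push_cast
  rfl

theorem exists_rat_le_two_rpow_neg (C : ℝ) : ∃ m : ℚ, C ≤ (2 : ℝ) ^ (-(m : ℝ)) := by
  obtain ⟨n, hn⟩ := pow_unbounded_of_one_lt C one_lt_two
  exact ⟨-n, by simpa using hn.le⟩

theorem mem_ESet_iff (hv : ∀ x, ‖x‖ = expNeg (v x)) :
    f ∈ ESet v ν ↔ IsBoundedLaurent ((2 : ℝ) ^ (-ν : ℝ)) f := by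
  simp only [ESet, Set.mem_ofPred, le_lterm_iff hv]
  constructor
  · rintro ⟨⟨c, hc⟩, h⟩
    refine ⟨⟨_, hc⟩, fun ε hε => ?_⟩
    obtain ⟨m, hm⟩ := exists_rat_two_rpow_neg_le hε
    obtain ⟨N, hN⟩ := h m
    exact ⟨N, fun i hi => (hN i hi).trans hm⟩
  · rintro ⟨⟨C, hC⟩, h⟩
    obtain ⟨c, hc⟩ := exists_rat_le_two_rpow_neg C
    exact ⟨⟨c, fun i => (hC i).trans hc⟩, fun m => h _ (by positivity)⟩

theorem mulL_eq_conv [IsUltrametricDist L] [CompleteSpace L] (hv : ∀ x, ‖x‖ = expNeg (v x))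
    (hf : f ∈ ESet v ν) (hg : g ∈ ESet v ν) : mulL v f g = conv f g := by
  rw [mem_ESet_iff hv] at hf hg
  funext n
  have hlim : Tendsto (psum f g n) atTop (𝓝 (conv f g n)) :=
    (hf.summable_mul (by positivity) hg n).hasSum.comp Finset.tendsto_Icc_neg
  have hex : ∃ l, ∀ m : ℤ, ∃ N₀ : ℕ, ∀ N : ℕ, N₀ ≤ N → (m : WithTop ℤ) ≤ v (psum f g n N - l) :=
    ⟨_, (tendsto_iff_valuation hv).1 hlim⟩
  rw [mulL, dif_pos hex]
  exact tendsto_nhds_unique ((tendsto_iff_valuation hv).2 hex.choose_spec) hlim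

/-- The weights of a nonzero element of `E` attain their maximum, and do so at a first index. -/
theorem exists_first_max_weight (hv : ∀ x, ‖x‖ = expNeg (v x)) (hf : f ∈ ESet v ν) (hf₀ : f ≠ 0) :
    ∃ i₀, f i₀ ≠ 0 ∧
      (∀ i, weight ((2 : ℝ) ^ (-ν : ℝ)) f i ≤ weight ((2 : ℝ) ^ (-ν : ℝ)) f i₀) ∧
      ∀ i < i₀, weight ((2 : ℝ) ^ (-ν : ℝ)) f i < weight ((2 : ℝ) ^ (-ν : ℝ)) f i₀ := by
  rw [mem_ESet_iff hv] at hf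
  have hval : ∀ i, f i ≠ 0 → ∃ n : ℤ, v (f i) = n := fun i hi => by
    refine Option.ne_none_iff_exists'.1 fun h => hi ?_
    rw [← norm_eq_zero, hv, h]
    rfl
  have hden : (0 : ℝ) < ν.den := by exact_mod_cast ν.den_pos
  have hν : (ν : ℝ) * ν.den = ν.num := by exact_mod_cast Rat.mul_den_eq_num ν
  set ρ : ℝ := (2 : ℝ) ^ (-ν : ℝ) with hρdef
  have hρ : 0 < ρ := by positivity
  obtain ⟨_, ⟨i₁, n₁, hn₁, rfl⟩, hmin⟩ := Int.exists_least_of_bdd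
    (P := fun z => ∃ i n : ℤ, v (f i) = n ∧ n * ν.den + ν.num * i = z)
    (by
      obtain ⟨C, hC⟩ := hf.bounded
      obtain ⟨c, hc⟩ := exists_rat_le_two_rpow_neg C
      refine ⟨⌊(c * ν.den : ℝ)⌋, ?_⟩
      rintro _ ⟨i, n, hn, rfl⟩
      have h := (hC i).trans hc
      rw [hρdef, weight_eq_rpow hv hn, Real.rpow_le_rpow_left_iff one_lt_two, neg_le_neg_iff] at h
      have h' := mul_le_mul_of_nonneg_right h hden.le
      have h'' : (⌊(c * ν.den : ℝ)⌋ : ℝ) ≤ ((n * ν.den + ν.num * i : ℤ) : ℝ) := by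
        refine (Int.floor_le _).trans (h'.trans (le_of_eq ?_))
        push_cast
        rw [← hν]
        ring
      exact_mod_cast h'')
    (by
      obtain ⟨i, hi⟩ := Function.ne_iff.1 hf₀
      obtain ⟨n, hn⟩ := hval i hi
      exact ⟨_, i, n, hn, rfl⟩)
  have hi₁ : weight ρ f i₁ = (2 : ℝ) ^ (-(n₁ + ν * i₁ : ℝ)) := weight_eq_rpow hv hn₁
  have hpos : 0 < weight ρ f i₁ := by rw [hi₁]; positivity
  have hmax : ∀ i, weight ρ f i ≤ weight ρ f i₁ := fun i => by
    by_cases hi : f i = 0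
    · simpa [weight, hi] using hpos.le
    · obtain ⟨n, hn⟩ := hval i hi
      have h : ((n₁ * ν.den + ν.num * i₁ : ℤ) : ℝ) ≤ ((n * ν.den + ν.num * i : ℤ) : ℝ) := by
        exact_mod_cast hmin _ ⟨i, n, hn, rfl⟩
      rw [hi₁, hρdef, weight_eq_rpow hv hn, Real.rpow_le_rpow_left_iff one_lt_two, neg_le_neg_iff]
      refine le_of_mul_le_mul_right ?_ hden
      push_cast at h
      rw [← hν] at h
      linarith
  obtain ⟨i₀, hi₀, hfirst⟩ := Int.exists_least_of_bdd (P := fun i => weight ρ f i = weight ρ f i₁)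
    (by
      obtain ⟨N, hN⟩ := hf.small _ (half_pos hpos)
      refine ⟨N, fun i hi => ?_⟩
      by_contra! hlt
      have := hN i hlt.le
      linarith)
    ⟨i₁, rfl⟩
  refine ⟨i₀, fun h => ?_, fun i => hi₀ ▸ hmax i, fun i hi => hi₀ ▸ (hmax i).lt_of_ne fun h => ?_⟩
  · rw [weight, h, norm_zero, zero_mul] at hi₀
    exact hpos.ne hi₀
  · exact (hfirst i h).not_gt hi

theorem ESet_field [IsUltrametricDist L] [CompleteSpace L] (hv : ∀ x, ‖x‖ = expNeg (v x)) (ν : ℚ) :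
    oneL ∈ ESet v ν ∧
    (∀ f ∈ ESet v ν, ∀ g ∈ ESet v ν, (fun n => f n + g n) ∈ ESet v ν) ∧
    (∀ f ∈ ESet v ν, (fun n => -(f n)) ∈ ESet v ν) ∧
    (∀ f ∈ ESet v ν, ∀ g ∈ ESet v ν, mulL v f g ∈ ESet v ν) ∧
    (∀ f ∈ ESet v ν, ∀ g ∈ ESet v ν, mulL v f g = mulL v g f) ∧
    (∀ f ∈ ESet v ν, ∀ g ∈ ESet v ν, ∀ h ∈ ESet v ν,
      mulL v (mulL v f g) h = mulL v f (mulL v g h)) ∧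
    (∀ f ∈ ESet v ν, ∀ g ∈ ESet v ν, ∀ h ∈ ESet v ν,
      mulL v f (fun n => g n + h n) = fun n => mulL v f g n + mulL v f h n) ∧
    (∀ f ∈ ESet v ν, f ≠ (fun _ => 0) → ∃ g ∈ ESet v ν, mulL v f g = oneL) := by
  have hmem : ∀ {f}, f ∈ ESet v ν ↔ IsBoundedLaurent ((2 : ℝ) ^ (-ν : ℝ)) f := mem_ESet_iff hv
  have hρ : 0 < (2 : ℝ) ^ (-ν : ℝ) := by positivity
  have hmul : ∀ {f g}, f ∈ ESet v ν → g ∈ ESet v ν → mulL v f g = conv f g :=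
    fun hf hg => mulL_eq_conv hv hf hg
  have hadd : ∀ {f g}, f ∈ ESet v ν → g ∈ ESet v ν → (fun n => f n + g n) ∈ ESet v ν :=
    fun hf hg => hmem.2 ((hmem.1 hf).add hρ (hmem.1 hg))
  have hconv : ∀ {f g}, f ∈ ESet v ν → g ∈ ESet v ν → conv f g ∈ ESet v ν :=
    fun hf hg => hmem.2 ((hmem.1 hf).conv hρ (hmem.1 hg))
  refine ⟨hmem.2 (isBoundedLaurent_oneL _), fun f hf g hg => hadd hf hg,
    fun f hf => hmem.2 (hmem.1 hf).neg, fun f hf g hg => ?_, fun f hf g hg => ?_,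
    fun f hf g hg h hh => ?_, fun f hf g hg h hh => ?_, fun f hf hf₀ => ?_⟩
  · rw [hmul hf hg]
    exact hconv hf hg
  · rw [hmul hf hg, hmul hg hf, conv_comm]
  · rw [hmul hf hg, hmul hg hh, hmul (hconv hf hg) hh, hmul hf (hconv hg hh)]
    exact conv_assoc hρ (hmem.1 hf) (hmem.1 hg) (hmem.1 hh)
  · rw [hmul hf hg, hmul hf hh, hmul hf (hadd hg hh)]
    exact conv_add hρ (hmem.1 hf) (hmem.1 hg) (hmem.1 hh)
  · obtain ⟨i₀, hi₀, hle, hlt⟩ := exists_first_max_weight hv hf hf₀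
    obtain ⟨g, hg, hfg⟩ := exists_conv_eq_oneL hρ (hmem.1 hf) hi₀ hle hlt
    exact ⟨g, hmem.2 hg, by rw [hmul hf (hmem.2 hg), hfg]⟩

end Valuation

end GaussLaurent

/-- **Statement 7.** The ring `E` is a field: it contains `1`, is stable under
addition, negation and multiplication (which is commutative, associative and
distributive on it), and every nonzero element of `E` has a multiplicative
inverse in `E`. -/
theorem statement7
    (vK : K → WithTop ℤ)
    (hv_zero : ∀ x : K, vK x = ⊤ ↔ x = 0)
    (hv_mul : ∀ x y : K, vK (x * y) = vK x + vK y)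
    (hv_add : ∀ x y : K, min (vK x) (vK y) ≤ vK (x + y))
    (hv_surj : Function.Surjective vK)
    (hv_complete : ∀ x : ℕ → K,
      (∀ n : ℕ, ((n : ℤ) : WithTop ℤ) ≤ vK (x (n + 1) - x n)) →
      ∃ l : K, ∀ n : ℕ, ((n : ℤ) : WithTop ℤ) ≤ vK (l - x n))
    (ν : ℚ)
    :
    oneL ∈ ESet vK ν ∧
    (∀ f ∈ ESet vK ν, ∀ g ∈ ESet vK ν, (fun n => f n + g n) ∈ ESet vK ν) ∧
    (∀ f ∈ ESet vK ν, (fun n => -(f n)) ∈ ESet vK ν) ∧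
    (∀ f ∈ ESet vK ν, ∀ g ∈ ESet vK ν, mulL vK f g ∈ ESet vK ν) ∧
    (∀ f ∈ ESet vK ν, ∀ g ∈ ESet vK ν, mulL vK f g = mulL vK g f) ∧
    (∀ f ∈ ESet vK ν, ∀ g ∈ ESet vK ν, ∀ h ∈ ESet vK ν,
      mulL vK (mulL vK f g) h = mulL vK f (mulL vK g h)) ∧
    (∀ f ∈ ESet vK ν, ∀ g ∈ ESet vK ν, ∀ h ∈ ESet vK ν,
      mulL vK f (fun n => g n + h n) =
        fun n => mulL vK f g n + mulL vK f h n) ∧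
    (∀ f ∈ ESet vK ν, f ≠ (fun _ => 0) →
      ∃ g ∈ ESet vK ν, mulL vK f g = oneL) := by
  let _ : NormedField K := (GaussLaurent.absOfValuation vK hv_zero hv_mul hv_add).toNormedField
  have hv : ∀ x : K, ‖x‖ = GaussLaurent.expNeg (vK x) := fun _ => rfl
  have : IsUltrametricDist K := GaussLaurent.isUltrametricDist_of_valuation hv hv_add
  have : CompleteSpace K := GaussLaurent.completeSpace_of_valuation hv hv_complete
  exact GaussLaurent.ESet_field hv ν
end
end

section
/- Let ν = 0, so S = ℛ[[u]], and let d be a positive integer. For a free submodule M ⊆ S^d, let M_π (resp. M_u) be the S_π-submodule (resp. S_u-submodule) of E^d generated by M. Then M = M_π ∩ M_u (intersection inside E^d). Consequently, the map M ↦ (M_π, M_u) from free submodules of S^d to pairs of free submodules of S_π^d and S_u^d is injective, and each pair in its image has unique preimage A ∩ B. -/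
noncomputable section

variable {K : Type} [Field K]

/-- Scalar multiplication of a vector of Laurent series by a Laurent series. -/
def smulV (vK : K → WithTop ℤ) {d : ℕ} (r : ℤ → K) (x : Fin d → ℤ → K) :
    Fin d → ℤ → K :=
  fun k => mulL vK r (x k)

/-- The set of finite `R`-linear combinations of elements of `X`:
the `R`-module generated by `X` inside the `d`-dimensional Laurent space. -/
def SpanL (vK : K → WithTop ℤ) (d : ℕ) (R : Set (ℤ → K))
    (X : Set (Fin d → ℤ → K)) : Set (Fin d → ℤ → K) :=
  {y | ∃ (m : ℕ) (r : Fin m → ℤ → K) (v : Fin m → Fin d → ℤ → K),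
    (∀ j, r j ∈ R) ∧ (∀ j, v j ∈ X) ∧
    y = fun k n => ∑ j, mulL vK (r j) (v j k) n}

/-- `M` is an `R`-submodule: contains `0` and is stable under addition and
under multiplication by scalars from `R`. -/
def IsSubmodL (vK : K → WithTop ℤ) (d : ℕ) (R : Set (ℤ → K))
    (M : Set (Fin d → ℤ → K)) : Prop :=
  (fun _ _ => (0 : K)) ∈ M ∧
  (∀ x ∈ M, ∀ y ∈ M, (fun k n => x k n + y k n) ∈ M) ∧
  (∀ r ∈ R, ∀ x ∈ M, smulV vK r x ∈ M)

/-- `M` is a free `R`-module: it admits a finite basis. -/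
def IsFreeL (vK : K → WithTop ℤ) (d : ℕ) (R : Set (ℤ → K))
    (M : Set (Fin d → ℤ → K)) : Prop :=
  ∃ (m : ℕ) (b : Fin m → Fin d → ℤ → K),
    (∀ j, b j ∈ M) ∧ M = SpanL vK d R (Set.range b) ∧
    ∀ r : Fin m → ℤ → K, (∀ j, r j ∈ R) →
      (fun k n => ∑ j, mulL vK (r j) (b j k) n) = (fun _ _ => (0 : K)) →
      ∀ j, r j = fun _ => 0

/-- `S = ℛ[[u]]`, viewed inside formal Laurent series: support in `ℕ` and
integral coefficients. -/
def SZSet (vK : K → WithTop ℤ) : Set (ℤ → K) :=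
  {f | (∀ i : ℤ, i < 0 → f i = 0) ∧ ∀ i : ℤ, (0 : WithTop ℤ) ≤ vK (f i)}

/-- `S_π = S[1/π]`: support in `ℕ` and coefficients with valuation bounded
below. -/
def SpiZSet (vK : K → WithTop ℤ) : Set (ℤ → K) :=
  {f | (∀ i : ℤ, i < 0 → f i = 0) ∧ ∃ c : ℤ, ∀ i : ℤ, (c : WithTop ℤ) ≤ vK (f i)}

/-- `S_u`: Laurent series with integral coefficients whose valuations tend to
`+∞` as `i → −∞`. -/
def SuZSet (vK : K → WithTop ℤ) : Set (ℤ → K) :=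
  {f | (∀ i : ℤ, (0 : WithTop ℤ) ≤ vK (f i)) ∧
    ∀ m : ℤ, ∃ N : ℤ, ∀ i : ℤ, i ≤ N → (m : WithTop ℤ) ≤ vK (f i)}

/-- Completeness of an additive valuation: every sequence whose consecutive differences have
valuation at least `n` converges at that rate. -/
class IsCompleteVal (v : AddValuation K (WithTop ℤ)) : Prop where
  exists_limit : ∀ x : ℕ → K,
    (∀ n : ℕ, ((n : ℤ) : WithTop ℤ) ≤ v (x (n + 1) - x n)) →
    ∃ l : K, ∀ n : ℕ, ((n : ℤ) : WithTop ℤ) ≤ v (l - x n)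

variable (v : AddValuation K (WithTop ℤ))

variable {v} in
theorem eq_zero_of_forall_le {x : K} (h : ∀ m : ℤ, (m : WithTop ℤ) ≤ v x) : x = 0 := by
  rw [← v.top_iff]
  cases hx : v x with
  | top => rfl
  | coe a =>
    have := h (a + 1)
    rw [hx, WithTop.coe_le_coe] at this
    omega

variable {v} in
theorem le_sub_trans {m : WithTop ℤ} {x y z : K} (h : m ≤ v (x - y)) (h' : m ≤ v (y - z)) :
    m ≤ v (x - z) := by
  simpa using v.map_le_add h h'

theorem exists_limit_of_cauchy [hc : IsCompleteVal v] {x : ℕ → K}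
    (h : ∀ m : ℤ, ∃ N0 : ℕ, ∀ N : ℕ, N0 ≤ N → ∀ N' : ℕ, N0 ≤ N' →
      (m : WithTop ℤ) ≤ v (x N - x N')) :
    ∃ l : K, ∀ m : ℤ, ∃ N0 : ℕ, ∀ N : ℕ, N0 ≤ N → (m : WithTop ℤ) ≤ v (x N - l) := by
  choose φ hφ using h
  let ψ : ℕ → ℕ := fun n => ∑ k ∈ Finset.range (n + 1), φ k
  have hψ : ∀ n : ℕ, φ n ≤ ψ n := fun n =>
    Finset.single_le_sum (f := fun k : ℕ => φ k) (fun _ _ => Nat.zero_le _)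
      (Finset.self_mem_range_succ n)
  have hmono : ∀ n, ψ n ≤ ψ (n + 1) := fun n => by
    simp only [ψ]
    rw [Finset.sum_range_succ _ (n + 1)]
    exact Nat.le_add_right _ _
  obtain ⟨l, hl⟩ := hc.exists_limit (fun n => x (ψ n))
    (fun n => hφ n _ ((hψ n).trans (hmono n)) _ (hψ n))
  refine ⟨l, fun m => ⟨ψ m.toNat, fun N hN => ?_⟩⟩
  have hm : (m : WithTop ℤ) ≤ ((m.toNat : ℤ) : WithTop ℤ) :=
    WithTop.coe_le_coe.2 (Int.self_le_toNat m)
  refine hm.trans (le_sub_trans (hφ m.toNat N ((hψ _).trans hN) _ (hψ _)) ?_)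
  rw [v.map_sub_swap]
  exact hl _

/-- The subring `ℛ[[u]]` of the field of Laurent series with finite principal part. -/
def integralSeries : Subring (HahnSeries ℤ K) where
  carrier := {s | (∀ i : ℤ, i < 0 → s.coeff i = 0) ∧ ∀ i : ℤ, (0 : WithTop ℤ) ≤ v (s.coeff i)}
  zero_mem' := by simp
  one_mem' := by
    constructor
    · intro i hi
      simp [HahnSeries.coeff_one, hi.ne]
    · intro i
      rw [HahnSeries.coeff_one]
      split_ifs <;> simp
  add_mem' := by
    rintro a b ⟨ha, ha'⟩ ⟨hb, hb'⟩
    exact ⟨fun i hi => by simp [ha i hi, hb i hi], fun i => v.map_le_add (ha' i) (hb' i)⟩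
  neg_mem' := by
    rintro a ⟨ha, ha'⟩
    exact ⟨fun i hi => by simp [ha i hi], fun i => by simpa using ha' i⟩
  mul_mem' := by
    rintro a b ⟨ha, ha'⟩ ⟨hb, hb'⟩
    constructor
    · intro i hi
      rw [HahnSeries.coeff_mul]
      refine Finset.sum_eq_zero fun p hp => ?_
      rw [Finset.mem_antidiagonal] at hp
      rcases lt_or_ge p.1 0 with h | h
      · rw [ha _ h, zero_mul]
      · rw [hb _ (by omega), mul_zero]
    · intro i
      rw [HahnSeries.coeff_mul]
      refine v.map_le_sum fun p _ => ?_
      rw [v.map_mul]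
      exact add_nonneg (ha' _) (hb' _)

variable {v}

theorem mem_integralSeries {s : HahnSeries ℤ K} :
    s ∈ integralSeries v ↔ s.coeff ∈ SZSet v := Iff.rfl

theorem exists_integralSeries {f : ℤ → K} (hf : f ∈ SZSet v) :
    ∃ s : integralSeries v, (s : HahnSeries ℤ K).coeff = f :=
  ⟨⟨HahnSeries.ofSuppBddBelow f ⟨0, fun i hi => by
    by_contra h
    exact hi (hf.1 i (not_le.1 h))⟩, by rw [mem_integralSeries]; exact hf⟩, rfl⟩

theorem le_coeff_mul {m : WithTop ℤ} {L : HahnSeries ℤ K} (hL : ∀ i, m ≤ v (L.coeff i))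
    (s : integralSeries v) (i : ℤ) : m ≤ v ((L * s).coeff i) := by
  rw [HahnSeries.coeff_mul]
  refine v.map_le_sum fun p _ => ?_
  rw [v.map_mul]
  exact le_add_of_le_of_nonneg (hL _) (s.2.2 _)

/-- The truncation of a formal Laurent series to exponents at least `-N`. -/
def truncL (f : ℤ → K) (N : ℕ) : HahnSeries ℤ K :=
  HahnSeries.ofSuppBddBelow (fun i => if -(N : ℤ) ≤ i then f i else 0) ⟨-(N : ℤ), fun i hi => by
    by_contra h
    exact hi (if_neg h)⟩

theorem coeff_truncL (f : ℤ → K) (N : ℕ) (i : ℤ) :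
    (truncL f N).coeff i = if -(N : ℤ) ≤ i then f i else 0 := rfl

theorem coeff_truncL_mul (f : ℤ → K) (s : integralSeries v) (n : ℤ) (N : ℕ) (hN : n ≤ N) :
    (truncL f N * s).coeff n = psum f (s : HahnSeries ℤ K).coeff n N := by
  rw [HahnSeries.coeff_mul, psum]
  refine Finset.sum_of_injOn Prod.fst ?_ ?_ ?_ ?_
  · intro p hp q hq h
    simp only [Finset.mem_coe, Finset.mem_antidiagonal] at hp hq
    exact Prod.ext h (by omega)
  · intro p hp
    simp only [Finset.mem_coe, Finset.mem_antidiagonal, HahnSeries.mem_support,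
      coeff_truncL] at hp
    have h1 : -(N : ℤ) ≤ p.1 := by
      by_contra h
      exact hp.1 (if_neg h)
    have h2 : 0 ≤ p.2 := by
      by_contra h
      exact hp.2.1 (s.2.1 _ (not_le.1 h))
    simp only [Finset.coe_Icc, Set.mem_Icc]
    omega
  · intro i hi h
    rw [Finset.mem_Icc] at hi
    by_contra h0
    refine h ⟨(i, n - i), ?_, rfl⟩
    simp only [Finset.mem_coe, Finset.mem_antidiagonal, HahnSeries.mem_support,
      coeff_truncL, if_pos hi.1]
    exact ⟨left_ne_zero_of_mul h0, right_ne_zero_of_mul h0, by ring⟩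
  · intro p hp
    simp only [Finset.mem_antidiagonal, HahnSeries.mem_support, coeff_truncL] at hp ⊢
    rw [if_pos (by by_contra h; exact hp.1 (if_neg h)), ← hp.2.2, add_sub_cancel_left]

variable (v) in
/-- Formal Laurent series whose coefficients tend to `0` at `-∞`. -/
def negNullSeries : AddSubgroup (ℤ → K) where
  carrier := {f | ∀ m : ℤ, ∃ N : ℤ, ∀ i : ℤ, i ≤ N → (m : WithTop ℤ) ≤ v (f i)}
  zero_mem' := by simp
  add_mem' := by
    intro f g hf hg m
    obtain ⟨N, hN⟩ := hf m
    obtain ⟨N', hN'⟩ := hg m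
    exact ⟨min N N', fun i hi =>
      v.map_le_add (hN i (hi.trans (min_le_left _ _))) (hN' i (hi.trans (min_le_right _ _)))⟩
  neg_mem' := by
    intro f hf m
    obtain ⟨N, hN⟩ := hf m
    exact ⟨N, fun i hi => by simpa using hN i hi⟩

theorem mem_negNullSeries_of_forall_lt {f : ℤ → K} (hf : ∀ i : ℤ, i < 0 → f i = 0) :
    f ∈ negNullSeries v := fun m => ⟨-1, fun i hi => by simp [hf i (by omega)]⟩

theorem truncL_approx {f : ℤ → K} (hf : f ∈ negNullSeries v) (m : ℤ) :
    ∃ N0 : ℕ, ∀ N : ℕ, N0 ≤ N → ∀ i, (m : WithTop ℤ) ≤ v ((truncL f N).coeff i - f i) := by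
  obtain ⟨N0, hN0⟩ := hf m
  refine ⟨(-N0).toNat, fun N hN i => ?_⟩
  rw [coeff_truncL]
  split_ifs with h
  · simp
  · rw [zero_sub, v.map_neg]
    exact hN0 i (by omega)

theorem le_coeff_sub_mul {m : WithTop ℤ} {f : ℤ → K} {L L' : HahnSeries ℤ K}
    (hL : ∀ i, m ≤ v (L.coeff i - f i)) (hL' : ∀ i, m ≤ v (L'.coeff i - f i))
    (s : integralSeries v) (i : ℤ) : m ≤ v ((L * s).coeff i - (L' * s).coeff i) := by
  rw [← HahnSeries.coeff_sub, ← sub_mul]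
  refine le_coeff_mul (fun j => ?_) s i
  rw [HahnSeries.coeff_sub]
  refine le_sub_trans (hL j) ?_
  rw [v.map_sub_swap]
  exact hL' j

theorem psum_tendsto_mulL [IsCompleteVal v] {f : ℤ → K} (hf : f ∈ negNullSeries v)
    (s : integralSeries v) (n m : ℤ) : ∃ N0 : ℕ, ∀ N : ℕ, N0 ≤ N →
      (m : WithTop ℤ) ≤ v (psum f (s : HahnSeries ℤ K).coeff n N -
        mulL v f (s : HahnSeries ℤ K).coeff n) := by
  have h : ∃ l : K, ∀ m : ℤ, ∃ N0 : ℕ, ∀ N : ℕ, N0 ≤ N →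
      (m : WithTop ℤ) ≤ v (psum f (s : HahnSeries ℤ K).coeff n N - l) := by
    refine exists_limit_of_cauchy v fun m => ?_
    obtain ⟨N0, hN0⟩ := truncL_approx hf m
    refine ⟨max N0 n.toNat, fun N hN N' hN' => ?_⟩
    rw [← coeff_truncL_mul f s n N (by omega), ← coeff_truncL_mul f s n N' (by omega)]
    exact le_coeff_sub_mul (hN0 N (by omega)) (hN0 N' (by omega)) s n
  rw [mulL, dif_pos h]
  exact h.choose_spec m

/-- Multiplication by an integral power series is determined by its values on approximations
by Laurent series with finite principal part. -/
theorem le_coeff_mul_sub_mulL [IsCompleteVal v] {f : ℤ → K} (hf : f ∈ negNullSeries v)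
    (s : integralSeries v) {m : ℤ} {L : HahnSeries ℤ K}
    (hL : ∀ i, (m : WithTop ℤ) ≤ v (L.coeff i - f i)) (n : ℤ) :
    (m : WithTop ℤ) ≤ v ((L * s).coeff n - mulL v f (s : HahnSeries ℤ K).coeff n) := by
  obtain ⟨N0, hN0⟩ := truncL_approx hf m
  obtain ⟨N1, hN1⟩ := psum_tendsto_mulL hf s n m
  have h := hN1 (max (max N0 N1) n.toNat) (by omega)
  rw [← coeff_truncL_mul f s n _ (by omega)] at h
  exact le_sub_trans (le_coeff_sub_mul hL (hN0 _ (by omega)) s n) h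

theorem mulL_coeff [IsCompleteVal v] {L : HahnSeries ℤ K} (hL : L.coeff ∈ negNullSeries v)
    (s : integralSeries v) : mulL v L.coeff (s : HahnSeries ℤ K).coeff = (L * s).coeff := by
  funext n
  refine (sub_eq_zero.1 (eq_zero_of_forall_le (v := v) fun m => ?_)).symm
  exact le_coeff_mul_sub_mulL hL s (by simp) n

theorem mulL_mem_negNullSeries [IsCompleteVal v] {f : ℤ → K} (hf : f ∈ negNullSeries v)
    (s : integralSeries v) : mulL v f (s : HahnSeries ℤ K).coeff ∈ negNullSeries v := by
  intro m
  obtain ⟨N0, hN0⟩ := truncL_approx hf m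
  refine ⟨-(N0 : ℤ) - 1, fun i hi => ?_⟩
  have h := le_coeff_mul_sub_mulL hf s (hN0 N0 le_rfl) i
  have h0 : (truncL f N0 * s).coeff i = 0 := by
    rw [HahnSeries.coeff_mul]
    refine Finset.sum_eq_zero fun p hp => ?_
    rw [Finset.mem_antidiagonal] at hp
    rcases lt_or_ge p.2 0 with h | h
    · rw [s.2.1 _ h, mul_zero]
    · rw [coeff_truncL, if_neg (by omega), zero_mul]
  rwa [h0, zero_sub, v.map_neg] at h

theorem eq_of_common_approx {f g : ℤ → K}
    (h : ∀ m : ℤ, ∃ L : HahnSeries ℤ K, ∀ i, (m : WithTop ℤ) ≤ v (L.coeff i - f i) ∧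
      (m : WithTop ℤ) ≤ v (L.coeff i - g i)) : f = g := by
  funext i
  refine sub_eq_zero.1 (eq_zero_of_forall_le (v := v) fun m => ?_)
  obtain ⟨L, hL⟩ := h m
  refine le_sub_trans (y := L.coeff i) ?_ (hL i).2
  rw [v.map_sub_swap]
  exact (hL i).1

instance [IsCompleteVal v] : SMul (integralSeries v) (negNullSeries v) :=
  ⟨fun s f => ⟨mulL v f (s : HahnSeries ℤ K).coeff, mulL_mem_negNullSeries f.2 s⟩⟩

theorem coe_smul_negNullSeries [IsCompleteVal v] (s : integralSeries v) (f : negNullSeries v) :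
    ((s • f : negNullSeries v) : ℤ → K) = mulL v f (s : HahnSeries ℤ K).coeff := rfl

theorem exists_approx (f : negNullSeries v) (m : ℤ) : ∃ L : HahnSeries ℤ K, ∀ i,
    (m : WithTop ℤ) ≤ v (L.coeff i - (f : ℤ → K) i) := by
  obtain ⟨N0, hN0⟩ := truncL_approx f.2 m
  exact ⟨_, hN0 N0 le_rfl⟩

theorem le_coeff_mul_sub_smul [IsCompleteVal v] {f : negNullSeries v} {m : ℤ}
    {L : HahnSeries ℤ K} (hL : ∀ i, (m : WithTop ℤ) ≤ v (L.coeff i - (f : ℤ → K) i))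
    (s : integralSeries v) (n : ℤ) :
    (m : WithTop ℤ) ≤ v ((L * s).coeff n - ((s • f : negNullSeries v) : ℤ → K) n) :=
  le_coeff_mul_sub_mulL f.2 s hL n

theorem le_coeff_add_sub_add {m : WithTop ℤ} {f g : ℤ → K} {L L' : HahnSeries ℤ K} {i : ℤ}
    (h : m ≤ v (L.coeff i - f i)) (h' : m ≤ v (L'.coeff i - g i)) :
    m ≤ v ((L + L').coeff i - (f + g) i) := by
  rw [HahnSeries.coeff_add, Pi.add_apply, add_sub_add_comm]
  exact v.map_le_add h h'

instance [IsCompleteVal v] : Module (integralSeries v) (negNullSeries v) where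
  one_smul f := Subtype.ext <| eq_of_common_approx (v := v) fun m => by
    obtain ⟨L, hL⟩ := exists_approx f m
    refine ⟨L, fun i => ⟨?_, hL i⟩⟩
    have := le_coeff_mul_sub_smul hL 1 i
    rwa [Subring.coe_one, mul_one] at this
  mul_smul s t f := Subtype.ext <| eq_of_common_approx (v := v) fun m => by
    obtain ⟨L, hL⟩ := exists_approx f m
    refine ⟨L * t * s, fun i => ⟨?_, le_coeff_mul_sub_smul (le_coeff_mul_sub_smul hL t) s i⟩⟩
    have := le_coeff_mul_sub_smul hL (s * t) i
    rwa [Subring.coe_mul, mul_comm (s : HahnSeries ℤ K), ← mul_assoc] at this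
  smul_zero s := Subtype.ext <| eq_of_common_approx (v := v) fun m =>
    ⟨0, fun i => ⟨by simpa using le_coeff_mul_sub_smul (f := 0) (L := 0) (m := m) (by simp) s i,
      by simp⟩⟩
  smul_add s f g := Subtype.ext <| eq_of_common_approx (v := v) fun m => by
    obtain ⟨L, hL⟩ := exists_approx f m
    obtain ⟨L', hL'⟩ := exists_approx g m
    refine ⟨(L + L') * s, fun i => ⟨le_coeff_mul_sub_smul (f := f + g)
      (fun j => le_coeff_add_sub_add (hL j) (hL' j)) s i, ?_⟩⟩
    rw [add_mul]
    exact le_coeff_add_sub_add (le_coeff_mul_sub_smul hL s i) (le_coeff_mul_sub_smul hL' s i)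
  add_smul s t f := Subtype.ext <| eq_of_common_approx (v := v) fun m => by
    obtain ⟨L, hL⟩ := exists_approx f m
    refine ⟨L * (s + t : integralSeries v), fun i => ⟨le_coeff_mul_sub_smul hL _ i, ?_⟩⟩
    rw [Subring.coe_add, mul_add]
    exact le_coeff_add_sub_add (le_coeff_mul_sub_smul hL s i) (le_coeff_mul_sub_smul hL t i)
  zero_smul f := Subtype.ext <| eq_of_common_approx (v := v) fun m => by
    obtain ⟨L, hL⟩ := exists_approx f m
    exact ⟨0, fun i => ⟨by simpa using le_coeff_mul_sub_smul hL 0 i, by simp⟩⟩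

/-- A nonzero series with bounded coefficients tending to `0` at `-∞` has a first coefficient
of minimal valuation. -/
theorem exists_first_min {f : ℤ → K} (hf : f ∈ negNullSeries v)
    (hb : ∃ c : ℤ, ∀ i : ℤ, (c : WithTop ℤ) ≤ v (f i)) (h0 : f ≠ 0) :
    ∃ i0 a : ℤ, v (f i0) = (a : WithTop ℤ) ∧ (∀ i, (a : WithTop ℤ) ≤ v (f i)) ∧
      ∀ i < i0, (a : WithTop ℤ) < v (f i) := by
  obtain ⟨c, hc⟩ := hb
  have hval : ∀ i, f i ≠ 0 → ∃ a : ℤ, v (f i) = (a : WithTop ℤ) := fun i hi =>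
    ⟨_, (WithTop.coe_untop _ (v.ne_top_iff.2 hi)).symm⟩
  obtain ⟨a, ⟨i1, hi1⟩, hmin⟩ := Int.exists_least_of_bdd
    (P := fun a : ℤ => ∃ i, v (f i) = (a : WithTop ℤ))
    ⟨c, fun z ⟨i, hi⟩ => by simpa [hi] using hc i⟩ (by
      obtain ⟨i, hi⟩ := Function.ne_iff.1 h0
      obtain ⟨a, ha⟩ := hval i hi
      exact ⟨a, i, ha⟩)
  have hle : ∀ i, (a : WithTop ℤ) ≤ v (f i) := fun i => by
    by_cases hi : f i = 0
    · simp [hi]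
    · obtain ⟨b, hb⟩ := hval i hi
      rw [hb]
      exact WithTop.coe_le_coe.2 (hmin b ⟨i, hb⟩)
  obtain ⟨N, hN⟩ := hf (a + 1)
  obtain ⟨i0, hi0, hmin0⟩ := Int.exists_least_of_bdd
    (P := fun i : ℤ => v (f i) = (a : WithTop ℤ))
    ⟨N, fun i hi => by
      by_contra h
      have := hN i (le_of_not_ge h)
      rw [hi, WithTop.coe_le_coe] at this
      omega⟩ ⟨i1, hi1⟩
  exact ⟨i0, a, hi0, hle, fun i hi => lt_of_le_of_ne (hle i) fun h =>
    absurd (hmin0 i h.symm) (not_le.2 hi)⟩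

/-- Bounded series have no torsion under multiplication by integral power series. -/
theorem eq_zero_of_smul_eq_zero [IsCompleteVal v] {s : integralSeries v} (hs : s ≠ 0)
    {f : negNullSeries v} (hb : ∃ c : ℤ, ∀ i : ℤ, (c : WithTop ℤ) ≤ v ((f : ℤ → K) i))
    (h : s • f = 0) : f = 0 := by
  by_contra hf
  have hs0 : (s : HahnSeries ℤ K).coeff ≠ 0 := fun h0 =>
    hs (Subtype.ext (HahnSeries.coeff_injective (by simpa using h0)))
  obtain ⟨i0, a, hi0, ha, hlt⟩ := exists_first_min f.2 hb fun h0 => hf (Subtype.ext h0)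
  obtain ⟨j0, c, hj0, hc, hlt'⟩ := exists_first_min
    (mem_negNullSeries_of_forall_lt s.2.1) ⟨0, s.2.2⟩ hs0
  obtain ⟨N0, hN0⟩ := psum_tendsto_mulL f.2 s (i0 + j0) (a + c + 1)
  have h1 := hN0 (max N0 i0.natAbs) (le_max_left _ _)
  rw [← coe_smul_negNullSeries, h, psum, ← Finset.add_sum_erase _ _
    (a := i0) (by rw [Finset.mem_Icc]; omega)] at h1
  have hval : v ((f : ℤ → K) i0 * (s : HahnSeries ℤ K).coeff (i0 + j0 - i0)) =
      ((a + c : ℤ) : WithTop ℤ) := by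
    rw [add_sub_cancel_left, v.map_mul, hi0, hj0, WithTop.coe_add]
  rw [ZeroMemClass.coe_zero, Pi.zero_apply, sub_zero, v.map_add_eq_of_lt_left, hval,
    WithTop.coe_le_coe] at h1
  · omega
  · rw [hval]
    refine v.map_lt_sum (WithTop.coe_ne_top) fun i hi => ?_
    rw [v.map_mul, WithTop.coe_add]
    rcases lt_or_gt_of_ne (Finset.ne_of_mem_erase hi) with h | h
    · exact WithTop.add_lt_add_of_lt_of_le WithTop.coe_ne_top (hlt i h) (hc _)
    · exact WithTop.add_lt_add_of_le_of_lt WithTop.coe_ne_top (ha i) (hlt' _ (by omega))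

/-- A matrix with linearly independent rows over a domain has a right inverse up to a nonzero
scalar. -/
theorem LinearIndependent.exists_right_inverse_up_to_scalar {A ι κ : Type*} [CommRing A]
    [IsDomain A] [Fintype ι] [DecidableEq ι] [Fintype κ] {B : ι → κ → A}
    (hB : LinearIndependent A B) :
    ∃ (C : κ → ι → A) (δ : A), δ ≠ 0 ∧
      ∀ i j, ∑ k, C k i * B j k = if j = i then δ else 0 := by
  classical
  let F := FractionRing A
  let B' : ι → κ → F := fun j k => algebraMap A F (B j k)
  have hB' : LinearIndependent F B' := by
    rw [← LinearIndependent.iff_fractionRing A F]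
    refine hB.map' ((Algebra.linearMap A F).compLeft κ) (LinearMap.ker_eq_bot.2 ?_)
    intro x y h
    funext k
    exact IsFractionRing.injective A F (congrFun h k)
  obtain ⟨g, hg⟩ := LinearMap.exists_leftInverse_of_injective (Fintype.linearCombination F B')
    (LinearMap.ker_eq_bot.2 hB'.fintypeLinearCombination_injective)
  have hg' : ∀ j, g (B' j) = Pi.single j 1 := fun j => by
    simpa using LinearMap.congr_fun hg (Pi.single j 1)
  obtain ⟨δ, hδ⟩ := IsLocalization.exist_integer_multiples_of_finite (nonZeroDivisors A)
    (fun p : κ × ι => g (Pi.single p.1 1) p.2)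
  choose C hC using hδ
  refine ⟨fun k i => C (k, i), δ, nonZeroDivisors.ne_zero δ.2, fun i j => ?_⟩
  apply IsFractionRing.injective A F
  have h : g (B' j) i = ∑ k, B' j k * g (Pi.single k 1) i := by
    conv_lhs => rw [pi_eq_sum_univ' (B' j)]
    simp only [map_sum, map_smul, Finset.sum_apply, Pi.smul_apply, smul_eq_mul]
  rw [hg'] at h
  calc algebraMap A F (∑ k, C (k, i) * B j k)
      = algebraMap A F δ * ∑ k, B' j k * g (Pi.single k 1) i := by
        rw [map_sum, Finset.mul_sum]
        refine Finset.sum_congr rfl fun k _ => ?_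
        rw [map_mul, hC, Algebra.smul_def]
        ring
    _ = algebraMap A F (if j = i then δ else 0) := by
        rw [← h, Pi.single_apply]
        by_cases hij : j = i
        · simp [hij]
        · simp [hij, Ne.symm hij]

variable (v) in
/-- The module `S_π` as a submodule over the integral power series. -/
def boundedSubmodule [IsCompleteVal v] : Submodule (integralSeries v) (negNullSeries v) where
  carrier := {f | (f : ℤ → K) ∈ SpiZSet v}
  zero_mem' := by simp [SpiZSet]
  add_mem' := by
    rintro f g ⟨hf, c, hc⟩ ⟨hg, c', hc'⟩
    refine ⟨fun i hi => ?_, min c c', fun i => v.map_le_add ?_ ?_⟩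
    · rw [AddSubgroup.coe_add, Pi.add_apply, hf i hi, hg i hi, add_zero]
    · exact le_trans (WithTop.coe_le_coe.2 (min_le_left _ _)) (hc i)
    · exact le_trans (WithTop.coe_le_coe.2 (min_le_right _ _)) (hc' i)
  smul_mem' := by
    rintro s ⟨f, hfN⟩ ⟨hf, c, hc⟩
    dsimp only at hf hc
    obtain ⟨L, rfl⟩ : ∃ L : HahnSeries ℤ K, L.coeff = f :=
      ⟨HahnSeries.ofSuppBddBelow f ⟨0, fun i hi => by
        by_contra h
        exact hi (hf i (not_le.1 h))⟩, rfl⟩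
    change mulL v L.coeff (s : HahnSeries ℤ K).coeff ∈ SpiZSet v
    rw [mulL_coeff hfN]
    refine ⟨fun i hi => ?_, c, le_coeff_mul hc s⟩
    rw [HahnSeries.coeff_mul]
    refine Finset.sum_eq_zero fun p hp => ?_
    rw [Finset.mem_antidiagonal] at hp
    rcases lt_or_ge p.1 0 with h | h
    · rw [hf _ h, zero_mul]
    · rw [s.2.1 _ (by omega), mul_zero]

variable (v) in
/-- The module `S_u` as a submodule over the integral power series. -/
def integralSubmodule [IsCompleteVal v] : Submodule (integralSeries v) (negNullSeries v) where
  carrier := {f | (f : ℤ → K) ∈ SuZSet v}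
  zero_mem' := by simp [SuZSet]
  add_mem' := by
    rintro f g ⟨hf, hf'⟩ ⟨hg, hg'⟩
    exact ⟨fun i => v.map_le_add (hf i) (hg i), (f + g).2⟩
  smul_mem' := by
    rintro s f ⟨hf, hf'⟩
    refine ⟨fun i => ?_, (s • f).2⟩
    obtain ⟨L, hL⟩ := exists_approx f 0
    have hL0 : ∀ i, ((0 : ℤ) : WithTop ℤ) ≤ v (L.coeff i) := fun i => by
      simpa using v.map_le_add (hL i) (hf i)
    have h := v.map_le_sub (le_coeff_mul hL0 s i) (le_coeff_mul_sub_smul hL s i)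
    rwa [sub_sub_cancel] at h

theorem coeff_mem_negNullSeries (s : integralSeries v) :
    (s : HahnSeries ℤ K).coeff ∈ negNullSeries v := mem_negNullSeries_of_forall_lt s.2.1

theorem sum_mulL_coeff [IsCompleteVal v] {ι : Type*} [Fintype ι] (r t : ι → integralSeries v) :
    (fun n => ∑ j, mulL v (r j : HahnSeries ℤ K).coeff (t j : HahnSeries ℤ K).coeff n) =
      ((∑ j, r j * t j : integralSeries v) : HahnSeries ℤ K).coeff := by
  funext n
  rw [AddSubmonoidClass.coe_finsetSum, HahnSeries.coeff_sum]
  exact Finset.sum_congr rfl fun j _ =>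
    congrFun (mulL_coeff (coeff_mem_negNullSeries (r j)) (t j)) n

theorem sum_mulL_eq_coe [IsCompleteVal v] {ι : Type*} [Fintype ι] (r : ι → negNullSeries v)
    (t : ι → integralSeries v) :
    (fun n => ∑ j, mulL v (r j : ℤ → K) (t j : HahnSeries ℤ K).coeff n) =
      ((∑ j, t j • r j : negNullSeries v) : ℤ → K) := by
  funext n
  rw [AddSubmonoidClass.coe_finsetSum, Finset.sum_apply]
  rfl

section Span

variable [IsCompleteVal v] {d m : ℕ} {B : Fin m → Fin d → integralSeries v}

theorem exists_coords_of_mem_span_range {x : Fin d → ℤ → K}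
    (hx : x ∈ SpanL v d (SZSet v)
      (Set.range fun j k => (B j k : HahnSeries ℤ K).coeff)) :
    ∃ T : Fin m → integralSeries v,
      ∀ k, x k = ((∑ j, T j * B j k : integralSeries v) : HahnSeries ℤ K).coeff := by
  obtain ⟨p, r, w, hr, hw, rfl⟩ := hx
  choose t ht using fun l => exists_integralSeries (hr l)
  choose σ hσ using hw
  refine ⟨fun j => ∑ l, if σ l = j then t l else 0, fun k => ?_⟩
  have h : ∑ j, (∑ l, if σ l = j then t l else 0) * B j k = ∑ l, t l * B (σ l) k := by
    simp only [Finset.sum_mul, ite_mul, zero_mul]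
    rw [Finset.sum_comm]
    simp
  rw [h, ← sum_mulL_coeff]
  simp only [ht, ← hσ]

theorem exists_coords_of_mem_span {R : Set (ℤ → K)}
    {P : Submodule (integralSeries v) (negNullSeries v)}
    (hR : ∀ f ∈ R, ∃ g ∈ P, (g : ℤ → K) = f) {y : Fin d → ℤ → K}
    (hy : y ∈ SpanL v d R (SpanL v d (SZSet v)
      (Set.range fun j k => (B j k : HahnSeries ℤ K).coeff))) :
    ∃ ρ : Fin m → negNullSeries v, (∀ j, ρ j ∈ P) ∧
      ∀ k, y k = ((∑ j, B j k • ρ j : negNullSeries v) : ℤ → K) := by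
  obtain ⟨p, r, w, hr, hw, rfl⟩ := hy
  choose g hgP hg using fun l => hR _ (hr l)
  choose T hT using fun l => exists_coords_of_mem_span_range (hw l)
  refine ⟨fun j => ∑ l, T l j • g l,
    fun j => P.sum_mem fun l _ => P.smul_mem _ (hgP l), fun k => ?_⟩
  have h : ∑ j, B j k • ∑ l, T l j • g l = ∑ l, (∑ j, T l j * B j k) • g l := by
    simp only [Finset.smul_sum, Finset.sum_smul, smul_smul]
    rw [Finset.sum_comm]
    simp only [mul_comm]
  rw [h, ← sum_mulL_eq_coe]
  simp only [hT, hg]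

theorem subset_span {R : Set (ℤ → K)} {M : Set (Fin d → ℤ → K)}
    (hM : ∀ x ∈ M, ∀ k, x k ∈ SZSet v) (hR : oneL ∈ R) : M ⊆ SpanL v d R M := by
  intro x hx
  refine ⟨1, fun _ => oneL, fun _ => x, fun _ => hR, fun _ => hx, ?_⟩
  funext k n
  obtain ⟨s, hs⟩ := exists_integralSeries (hM x hx k)
  have h1 : (oneL : ℤ → K) = ((1 : integralSeries v) : HahnSeries ℤ K).coeff := by
    funext i
    simp [oneL, HahnSeries.coeff_one]
  simp only [Fin.sum_univ_one]
  rw [← hs, h1, mulL_coeff (coeff_mem_negNullSeries 1), Subring.coe_one,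
    one_mul]

theorem eq_span_inter_span {M : Set (Fin d → ℤ → K)}
    (hM : ∀ x ∈ M, ∀ k, x k ∈ SZSet v) (hfree : IsFreeL v d (SZSet v) M) :
    M = SpanL v d (SpiZSet v) M ∩ SpanL v d (SuZSet v) M := by
  have h01 : ∀ i : ℤ, (0 : WithTop ℤ) ≤ v (oneL i : K) := fun i => by
    unfold oneL
    split_ifs <;> simp
  have hneg : ∀ i : ℤ, i < 0 → (oneL i : K) = 0 := fun i hi => if_neg hi.ne
  refine Set.Subset.antisymm (Set.subset_inter
    (subset_span hM ⟨hneg, 0, h01⟩)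
    (subset_span hM ⟨h01, mem_negNullSeries_of_forall_lt hneg⟩)) ?_
  obtain ⟨m, b, hbM, hspan, hind⟩ := hfree
  choose B hB using fun j k => exists_integralSeries (hM _ (hbM j) k)
  obtain rfl : (fun j k => (B j k : HahnSeries ℤ K).coeff) = b := by
    funext j k
    exact hB j k
  have hli : LinearIndependent (integralSeries v) B := by
    rw [Fintype.linearIndependent_iff]
    intro t ht j
    have h0 := hind (fun j => (t j : HahnSeries ℤ K).coeff) (fun j => (t j).2) (by
      funext k
      rw [sum_mulL_coeff]
      have : ∑ j, t j * B j k = 0 := by simpa using congrFun ht k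
      rw [this]
      rfl) j
    exact Subtype.ext (HahnSeries.coeff_injective h0)
  obtain ⟨C, δ, hδ, hC⟩ := hli.exists_right_inverse_up_to_scalar
  rintro y ⟨hy, hy'⟩
  rw [hspan] at hy hy' ⊢
  obtain ⟨ρ, hρP, hρ⟩ := exists_coords_of_mem_span (P := boundedSubmodule v)
    (fun f hf => ⟨⟨f, mem_negNullSeries_of_forall_lt hf.1⟩, hf, rfl⟩) hy
  obtain ⟨τ, hτP, hτ⟩ := exists_coords_of_mem_span (P := integralSubmodule v)
    (fun f hf => ⟨⟨f, hf.2⟩, hf, rfl⟩) hy'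
  have hcramer : ∀ (θ : Fin m → negNullSeries v) (i : Fin m),
      ∑ k, C k i • ∑ j, B j k • θ j = δ • θ i := fun θ i => by
    simp only [Finset.smul_sum, smul_smul]
    rw [Finset.sum_comm]
    simp only [← Finset.sum_smul, hC, ite_smul, zero_smul, Finset.sum_ite_eq', Finset.mem_univ,
      if_true]
  have heq : ∀ i, ρ i = τ i := fun i => by
    refine sub_eq_zero.1 (eq_zero_of_smul_eq_zero hδ ?_ ?_)
    · obtain ⟨-, c, hc⟩ := hρP i
      refine ⟨min c 0, fun n => v.map_le_sub ?_ ?_⟩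
      · exact le_trans (WithTop.coe_le_coe.2 (min_le_left _ _)) (hc n)
      · exact le_trans (WithTop.coe_le_coe.2 (min_le_right _ _)) ((hτP i).1 n)
    · rw [smul_sub, ← hcramer ρ, ← hcramer τ, sub_eq_zero]
      refine Finset.sum_congr rfl fun k _ => ?_
      rw [Subtype.ext ((hρ k).symm.trans (hτ k))]
  refine ⟨m, fun j => ρ j, _, fun j => ⟨(hρP j).1, fun n => ?_⟩, fun j => ⟨j, rfl⟩, ?_⟩
  · dsimp only
    rw [heq]
    exact (hτP j).1 n
  · funext k
    rw [hρ k, ← sum_mulL_eq_coe]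

end Span

/-- **Statement 13.** (`ν = 0`, `S = ℛ[[u]]`.)  For a free submodule
`M ⊆ S^d`, with `M_π` (resp. `M_u`) the `S_π`- (resp. `S_u`-) submodule of
`E^d` generated by `M`, one has `M = M_π ∩ M_u`.  Consequently the map
`M ↦ (M_π, M_u)` is injective on free submodules of `S^d` (and each pair in
its image has unique preimage `A ∩ B`). -/
theorem statement13
    (vK : K → WithTop ℤ)
    (hv_zero : ∀ x : K, vK x = ⊤ ↔ x = 0)
    (hv_mul : ∀ x y : K, vK (x * y) = vK x + vK y)
    (hv_add : ∀ x y : K, min (vK x) (vK y) ≤ vK (x + y))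
    (hv_surj : Function.Surjective vK)
    (hv_complete : ∀ x : ℕ → K,
      (∀ n : ℕ, ((n : ℤ) : WithTop ℤ) ≤ vK (x (n + 1) - x n)) →
      ∃ l : K, ∀ n : ℕ, ((n : ℤ) : WithTop ℤ) ≤ vK (l - x n))
    (d : ℕ) (hd : 0 < d)
    (M M' : Set (Fin d → ℤ → K))
    (hMamb : ∀ x ∈ M, ∀ k, x k ∈ SZSet vK)
    (hMsub : IsSubmodL vK d (SZSet vK) M)
    (hMfree : IsFreeL vK d (SZSet vK) M)
    (hM'amb : ∀ x ∈ M', ∀ k, x k ∈ SZSet vK)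
    (hM'sub : IsSubmodL vK d (SZSet vK) M')
    (hM'free : IsFreeL vK d (SZSet vK) M') :
    M = SpanL vK d (SpiZSet vK) M ∩ SpanL vK d (SuZSet vK) M ∧
    (SpanL vK d (SpiZSet vK) M = SpanL vK d (SpiZSet vK) M' →
      SpanL vK d (SuZSet vK) M = SpanL vK d (SuZSet vK) M' → M = M') := by
  have h1 : vK 1 = 0 := by
    obtain ⟨a, ha⟩ := WithTop.ne_top_iff_exists.1 (mt (hv_zero 1).1 one_ne_zero)
    have h := hv_mul 1 1
    rw [mul_one, ← ha, ← WithTop.coe_add, WithTop.coe_eq_coe] at h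
    rw [← ha, ← WithTop.coe_zero, WithTop.coe_eq_coe]
    omega
  obtain ⟨v, rfl⟩ : ∃ v : AddValuation K (WithTop ℤ), vK = v :=
    ⟨AddValuation.of vK ((hv_zero 0).2 rfl) h1 hv_add hv_mul, rfl⟩
  have : IsCompleteVal v := ⟨hv_complete⟩
  have hM := eq_span_inter_span hMamb hMfree
  have hM' := eq_span_inter_span hM'amb hM'free
  refine ⟨hM, fun hπ hu => ?_⟩
  rw [hM, hM', ← hπ, ← hu, ← hM]
end
end
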